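/- Let G be a connected graph of order n ≥ 15. If |E(G)| ≥ C(n−4, 2) + 5, then pc(G) ≤ 3. -/

import Mathlib

/-- A walk in an edge-colored graph is *proper* if no two consecutive edges share a color. -/
def ProperWalk {V : Type*} {G : SimpleGraph V} (c : Sym2 V → ℕ) {u v : V}
    (p : G.Walk u v) : Prop :=
  p.edges.Chain' fun e f => c e ≠ c f

/-- `c` is a proper-path coloring of `G`: every pair of distinct vertices is joined by a
proper path. -/
def IsProperPathColoring {V : Type*} (G : SimpleGraph V) (c : Sym2 V → ℕ) : Prop :=
  ∀ u v : V, u ≠ v → ∃ p : G.Walk u v, p.IsPath ∧ ProperWalk c p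

/-- The proper connection number: the least `k` such that some coloring of the edges with
colors `0, …, k-1` is a proper-path coloring. -/
noncomputable def pc {V : Type*} (G : SimpleGraph V) : ℕ :=
  sInf {k | ∃ c : Sym2 V → ℕ, (∀ e ∈ G.edgeSet, c e < k) ∧ IsProperPathColoring G c}

/-- `G` has the strong property under `c`: any two distinct vertices are joined by two proper
paths whose first-edge colors differ and whose last-edge colors differ. -/
def HasStrongProperty {V : Type*} (G : SimpleGraph V) (c : Sym2 V → ℕ) : Prop :=
  ∀ u v : V, u ≠ v → ∃ p q : G.Walk u v, p.IsPath ∧ q.IsPath ∧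
    ProperWalk c p ∧ ProperWalk c q ∧
    p.edges.head?.map c ≠ q.edges.head?.map c ∧
    p.edges.getLast?.map c ≠ q.edges.getLast?.map c

/-- `c` makes `G` 2-proper connected: any two distinct vertices are joined by two
internally vertex-disjoint proper paths. -/
def Is2ProperConnected {V : Type*} (G : SimpleGraph V) (c : Sym2 V → ℕ) : Prop :=
  ∀ u v : V, u ≠ v → ∃ p q : G.Walk u v, p.IsPath ∧ q.IsPath ∧
    ProperWalk c p ∧ ProperWalk c q ∧ p ≠ q ∧
    ∀ x, x ∈ p.support → x ∈ q.support → x = u ∨ x = v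

/-- The 2-proper connection number. -/
noncomputable def pc2 {V : Type*} (G : SimpleGraph V) : ℕ :=
  sInf {k | ∃ c : Sym2 V → ℕ, (∀ e ∈ G.edgeSet, c e < k) ∧ Is2ProperConnected G c}


def PP {V : Type*} (G : SimpleGraph V) (c : Sym2 V → ℕ) (S : Set V) (u v : V) (α β : ℕ) : Prop :=
  ∃ p : G.Walk u v, p.IsPath ∧ ProperWalk c p ∧ (∀ x ∈ p.support, x ∈ S) ∧
    (p.edges.map c).head? = some α ∧ (p.edges.map c).getLast? = some β

theorem PP.symm {V : Type*} {G : SimpleGraph V} {c : Sym2 V → ℕ} {S : Set V} {u v : V} {α β : ℕ}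
    (h : PP G c S u v α β) : PP G c S v u β α := by
  obtain ⟨p, hp, hc, hs, h1, h2⟩ := h
  refine ⟨p.reverse, hp.reverse, ?_, ?_, ?_, ?_⟩
  · unfold ProperWalk at *
    rw [SimpleGraph.Walk.edges_reverse]
    refine List.isChain_reverse.2 ?_
    exact hc.imp (fun a b h => h.symm)
  · simpa using hs
  · rw [SimpleGraph.Walk.edges_reverse, List.map_reverse, List.head?_reverse, h2]
  · rw [SimpleGraph.Walk.edges_reverse, List.map_reverse, List.getLast?_reverse, h1]

theorem PP.edge {V : Type*} {G : SimpleGraph V} {c : Sym2 V → ℕ} {S : Set V} {u v : V}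
    (h : G.Adj u v) (hu : u ∈ S) (hv : v ∈ S) : PP G c S u v (c s(u, v)) (c s(u, v)) := by
  refine ⟨h.toWalk, ?_, ?_, ?_, ?_, ?_⟩
  · simp [SimpleGraph.Adj.toWalk, SimpleGraph.Walk.cons_isPath_iff, h.ne]
  · exact List.isChain_singleton _
  · simp [SimpleGraph.Adj.toWalk, hu, hv]
  · simp [SimpleGraph.Adj.toWalk]
  · simp [SimpleGraph.Adj.toWalk]

theorem PP.cons {V : Type*} {G : SimpleGraph V} {c : Sym2 V → ℕ} {S : Set V} {x y z : V} {α β : ℕ}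
    (h : G.Adj y x) (hy : y ∉ S) (hp : PP G c S x z α β) (hne : c s(y, x) ≠ α) :
    PP G c (insert y S) y z (c s(y, x)) β := by
  obtain ⟨p, hp, hc, hs, h1, h2⟩ := hp
  refine ⟨SimpleGraph.Walk.cons h p, ?_, ?_, ?_, ?_, ?_⟩
  · rw [SimpleGraph.Walk.cons_isPath_iff]
    exact ⟨hp, fun h => hy (hs _ h)⟩
  · unfold ProperWalk at *
    rw [SimpleGraph.Walk.edges_cons]
    cases he : p.edges with
    | nil => exact List.isChain_singleton _
    | cons e l =>
      rw [he] at hc h1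
      simp at h1
      refine List.isChain_cons_cons.2 ⟨?_, hc⟩
      rw [h1]; exact hne
  · intro w hw
    rw [SimpleGraph.Walk.support_cons] at hw
    rcases List.mem_cons.1 hw with rfl | hw
    · exact Set.mem_insert _ _
    · exact Set.mem_insert_of_mem _ (hs _ hw)
  · simp
  · rw [SimpleGraph.Walk.edges_cons, List.map_cons]
    cases he : p.edges with
    | nil => rw [he] at h1; simp at h1
    | cons e l => rw [he] at h2; simpa using h2

theorem PP.mono {V : Type*} {G : SimpleGraph V} {c c' : Sym2 V → ℕ} {S S' : Set V} {x z : V}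
    {α β : ℕ} (hS : S ⊆ S') (hc : ∀ u ∈ S, ∀ v ∈ S, c' s(u, v) = c s(u, v))
    (hp : PP G c S x z α β) : PP G c' S' x z α β := by
  obtain ⟨p, hp, hcc, hs, h1, h2⟩ := hp
  have key : ∀ e ∈ p.edges, c' e = c e := by
    intro e
    induction e using Sym2.ind with
    | _ u v =>
    intro he
    exact hc _ (hs _ (p.fst_mem_support_of_mem_edges he)) _ (hs _ (p.snd_mem_support_of_mem_edges he))
  have hm : p.edges.map c' = p.edges.map c := List.map_congr_left key
  refine ⟨p, hp, ?_, fun x hx => hS (hs x hx), by rw [hm, h1], by rw [hm, h2]⟩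
  have h3 : (p.edges.map c).IsChain (· ≠ ·) := (List.isChain_map c).2 hcc
  rw [← hm] at h3
  exact (List.isChain_map c').1 h3

/-- A valid state: coloring, slots. -/
def Good {V : Type*} (G : SimpleGraph V) (S : Set V) (cap : V → ℕ) : Prop :=
  ∃ (c : Sym2 V → ℕ) (T : V → Finset ℕ), (∀ e, c e < 3) ∧ (∀ v, T v ⊆ Finset.range 3) ∧
    (∀ v, cap v ≤ (T v).card) ∧
    (∀ u ∈ S, ∀ v ∈ S, u ≠ v → ∃ α β, PP G c S u v α β) ∧
    (∀ x ∈ S, ∀ γ ∈ T x, ∀ z ∈ S, z ≠ x → ∃ α β, α ≠ γ ∧ PP G c S x z α β) ∧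
    (∀ x ∈ S, ∀ γ ∈ T x, ∀ z ∈ S, ∀ δ ∈ T z, z ≠ x →
      ∃ α β, α ≠ γ ∧ β ≠ δ ∧ PP G c S x z α β)

theorem Good.pc_le {V : Type*} {G : SimpleGraph V} {cap : V → ℕ} (h : Good G Set.univ cap) :
    pc G ≤ 3 := by
  obtain ⟨c, T, hc, -, -, h, -, -⟩ := h
  refine Nat.sInf_le ⟨c, fun e _ => hc e, fun u v huv => ?_⟩
  obtain ⟨α, β, p, hp, hpc, -⟩ := h u trivial v trivial huv
  exact ⟨p, hp, hpc⟩

theorem Good.step {V : Type*} [DecidableEq V] {G : SimpleGraph V} {S : Set V} {cap : V → ℕ}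
    (h : Good G S cap) {x y : V} (hx : x ∈ S) (hy : y ∉ S) (hxy : G.Adj y x) (hcap : 1 ≤ cap x) :
    Good G (insert y S) (fun v => if v = y then 2 else if v = x then cap x - 1 else cap v) := by
  obtain ⟨c, T, hc, hT, hTc, hpc, hfree, hcomp⟩ := h
  have hne : y ≠ x := fun h => hy (h ▸ hx)
  obtain ⟨γ, hγ⟩ : (T x).Nonempty := Finset.card_pos.1 (lt_of_lt_of_le hcap (hTc x))
  have hγ3 : γ < 3 := Finset.mem_range.1 (hT x hγ)
  set c' : Sym2 V → ℕ := fun e => if e = s(y, x) then γ else c e with hc'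
  have cyx : c' s(y, x) = γ := by simp [hc']
  have hagree : ∀ u ∈ S, ∀ v ∈ S, c' s(u, v) = c s(u, v) := by
    intro u hu v hv
    have : s(u, v) ≠ s(y, x) := by
      intro h
      rw [Sym2.eq_iff] at h
      rcases h with ⟨rfl, rfl⟩ | ⟨rfl, rfl⟩ <;> contradiction
    simp [hc', this]
  have lift : ∀ {u v α β}, PP G c S u v α β → PP G c' (insert y S) u v α β :=
    fun h => h.mono (Set.subset_insert _ _) hagree
  have lift2 : ∀ {v α β}, PP G c S x v α β → γ ≠ α → PP G c' (insert y S) y v γ β := by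
    intro v α β h hn
    have := PP.cons (c := c') hxy hy (h.mono (le_refl S) hagree) (by rw [cyx]; exact hn)
    rwa [cyx] at this
  have hedge : PP G c' (insert y S) y x γ γ := by
    have := PP.edge (c := c') (S := insert y S) hxy (Set.mem_insert _ _) (Set.mem_insert_of_mem _ hx)
    rwa [cyx] at this
  -- from y to anything in S
  have fromy : ∀ v ∈ S, ∃ β, PP G c' (insert y S) y v γ β := by
    intro v hv
    by_cases hvx : v = x
    · subst hvx; exact ⟨γ, hedge⟩
    · obtain ⟨α, β, hα, hp⟩ := hfree x hx γ hγ v hv hvx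
      exact ⟨β, lift2 hp hα.symm⟩
  have fromy2 : ∀ v ∈ S, ∀ δ ∈ T v, (v = x → δ ≠ γ) → ∃ β, β ≠ δ ∧ PP G c' (insert y S) y v γ β := by
    intro v hv δ hδ hd
    by_cases hvx : v = x
    · subst hvx; exact ⟨γ, (hd rfl).symm, hedge⟩
    · obtain ⟨α, β, hα, hβ, hp⟩ := hcomp x hx γ hγ v hv δ hδ hvx
      exact ⟨β, hβ, lift2 hp hα.symm⟩
  let T' : V → Finset ℕ := fun v => if v = y then (Finset.range 3).erase γ else
    if v = x then (T x).erase γ else T v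
  have hTy : ∀ δ ∈ T' y, δ ≠ γ := by
    intro δ h; simp [T'] at h; exact h.1
  have hTx : ∀ v ∈ S, ∀ δ ∈ T' v, δ ∈ T v ∧ (v = x → δ ≠ γ) := by
    intro v hv δ h
    have : v ≠ y := fun h => hy (h ▸ hv)
    simp only [T', this, if_false] at h
    split_ifs at h with h1
    · subst h1; exact ⟨Finset.mem_of_mem_erase h, fun _ => Finset.ne_of_mem_erase h⟩
    · exact ⟨h, fun h2 => absurd h2 h1⟩
  refine ⟨c', T', ?_, ?_, ?_, ?_, ?_, ?_⟩
  · intro e; simp only [hc']; split_ifs; exacts [hγ3, hc e]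
  · intro v; simp only [T']; split_ifs
    · exact Finset.erase_subset _ _
    · exact (Finset.erase_subset _ _).trans (hT x)
    · exact hT v
  · intro v; simp only [T']; split_ifs
    · rw [Finset.card_erase_of_mem (Finset.mem_range.2 hγ3)]; simp
    · rw [Finset.card_erase_of_mem hγ]; have := hTc x; omega
    · exact hTc v
  · intro u hu v hv huv
    rcases hu with rfl | hu <;> rcases hv with rfl | hv
    · exact absurd rfl huv
    · obtain ⟨β, h⟩ := fromy v hv; exact ⟨_, _, h⟩
    · obtain ⟨β, h⟩ := fromy u hu; exact ⟨_, _, h.symm⟩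
    · obtain ⟨α, β, h⟩ := hpc u hu v hv huv; exact ⟨_, _, lift h⟩
  · intro u hu δ hδ v hv huv
    rcases hu with rfl | hu <;> rcases hv with rfl | hv
    · exact absurd rfl huv
    · obtain ⟨β, h⟩ := fromy v hv; exact ⟨_, _, (hTy δ hδ).symm, h⟩
    · obtain ⟨h1, h2⟩ := hTx u hu δ hδ
      obtain ⟨β, hβ, h⟩ := fromy2 u hu δ h1 h2; exact ⟨_, _, hβ, h.symm⟩
    · obtain ⟨h1, h2⟩ := hTx u hu δ hδ
      obtain ⟨α, β, h3, h⟩ := hfree u hu δ h1 v hv huv; exact ⟨_, _, h3, lift h⟩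
  · intro u hu δ hδ v hv ε hε huv
    rcases hu with rfl | hu <;> rcases hv with rfl | hv
    · exact absurd rfl huv
    · obtain ⟨h1, h2⟩ := hTx v hv ε hε
      obtain ⟨β, hβ, h⟩ := fromy2 v hv ε h1 h2; exact ⟨_, _, (hTy δ hδ).symm, hβ, h⟩
    · obtain ⟨h1, h2⟩ := hTx u hu δ hδ
      obtain ⟨β, hβ, h⟩ := fromy2 u hu δ h1 h2; exact ⟨_, _, hβ, (hTy ε hε).symm, h.symm⟩
    · obtain ⟨h1, h2⟩ := hTx u hu δ hδ
      obtain ⟨h3, h4⟩ := hTx v hv ε hε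
      obtain ⟨α, β, h5, h6, h⟩ := hcomp u hu δ h1 v hv ε h3 huv; exact ⟨_, _, h5, h6, lift h⟩

/-- strongly connected orientation on K of bichromatic edges -/
structure Strong {V : Type*} (G : SimpleGraph V) (s : V → Bool) (K : Set V) (D : V → V → Prop) :
    Prop where
  sub : ∀ x y, D x y → G.Adj x y ∧ s x ≠ s y ∧ x ∈ K ∧ y ∈ K
  asymm : ∀ x y, D x y → ¬ D y x
  conn : ∀ x ∈ K, ∀ y ∈ K, Relation.ReflTransGen D x y

theorem exists_path_of_rtg {V : Type*} {G : SimpleGraph V} {D : V → V → Prop}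
    (hD : ∀ x y, D x y → G.Adj x y) {u v : V} (h : Relation.ReflTransGen D u v) :
    ∃ p : G.Walk u v, p.IsPath ∧ ∀ d ∈ p.darts, D d.fst d.snd := by
  classical
  induction h using Relation.ReflTransGen.head_induction_on with
  | refl => exact ⟨SimpleGraph.Walk.nil, by simp, by simp⟩
  | @head a b hab _ ih =>
    obtain ⟨p, hp, hd⟩ := ih
    by_cases ha : a ∈ p.support
    · exact ⟨p.dropUntil a ha, hp.dropUntil ha, fun d h => hd d (p.darts_dropUntil_subset_darts ha h)⟩
    · refine ⟨SimpleGraph.Walk.cons (hD _ _ hab) p, ?_, ?_⟩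
      · rw [SimpleGraph.Walk.cons_isPath_iff]; exact ⟨hp, ha⟩
      · intro d h
        rw [SimpleGraph.Walk.darts_cons] at h
        rcases List.mem_cons.1 h with rfl | h
        · exact hab
        · exact hd d h

def bcol (b : Bool) : ℕ := if b then 0 else 1

theorem walk_alt {V : Type*} {G : SimpleGraph V} {D : V → V → Prop} {c : Sym2 V → ℕ} {s : V → Bool}
    (hD : ∀ x y, D x y → s x ≠ s y ∧ c s(x, y) = bcol (s x)) {u v : V} (p : G.Walk u v)
    (hp : ∀ d ∈ p.darts, D d.fst d.snd) :
    ProperWalk c p ∧ (p.edges ≠ [] → (p.edges.map c).head? = some (bcol (s u)) ∧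
      (p.edges.map c).getLast? = some (bcol (!s v))) := by
  induction p with
  | nil => exact ⟨List.isChain_nil, fun h => absurd rfl h⟩
  | @cons u w v h p ih =>
    have h0 : D u w := hp ⟨(u, w), h⟩ (by simp)
    obtain ⟨h1, h2⟩ := ih (fun d hd => hp d (by simp [hd]))
    obtain ⟨h3, h4⟩ := hD _ _ h0
    unfold ProperWalk at *
    rw [SimpleGraph.Walk.edges_cons]
    cases p with
    | nil =>
      refine ⟨List.isChain_singleton _, fun _ => ⟨by simp [h4], ?_⟩⟩
      have : s u = !s w := by revert h3; cases s u <;> cases s w <;> simp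
      simp [h4, this]
    | @cons _ w' _ h' p' =>
      have h5 : D w w' := hp ⟨(w, w'), h'⟩ (by simp)
      obtain ⟨h6, h7⟩ := hD _ _ h5
      rw [SimpleGraph.Walk.edges_cons] at h1 ⊢
      refine ⟨List.isChain_cons_cons.2 ⟨?_, h1⟩, fun _ => ⟨by simp [h4], ?_⟩⟩
      · rw [h4, h7]; revert h3; cases s u <;> cases s w <;> simp [bcol]
      · have := (h2 (by simp)).2
        rw [SimpleGraph.Walk.edges_cons] at this
        simpa using this

theorem Strong.exists_PP {V : Type*} {G : SimpleGraph V} {s : V → Bool} {K : Set V}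
    {D : V → V → Prop} (h : Strong G s K D) :
    ∃ c : Sym2 V → ℕ, (∀ e, c e < 3) ∧ ∀ u ∈ K, ∀ v ∈ K, u ≠ v →
      PP G c K u v (bcol (s u)) (bcol (!s v)) ∧ PP G c K u v (bcol (!s u)) (bcol (s v)) := by
  classical
  let c : Sym2 V → ℕ := fun e => if ∃ x y, e = s(x, y) ∧ D x y ∧ s x = false then 1 else 0
  have hc : ∀ x y, D x y → s x ≠ s y ∧ c s(x, y) = bcol (s x) := by
    intro x y hxy
    refine ⟨(h.sub x y hxy).2.1, ?_⟩
    cases hs : s x with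
    | false =>
      have : ∃ x' y', s(x, y) = s(x', y') ∧ D x' y' ∧ s x' = false := ⟨x, y, rfl, hxy, hs⟩
      simp only [c, if_pos this, bcol]; simp
    | true =>
      have : ¬ ∃ x' y', s(x, y) = s(x', y') ∧ D x' y' ∧ s x' = false := by
        rintro ⟨x', y', he, hd, hf⟩
        rcases Sym2.eq_iff.1 he with ⟨rfl, rfl⟩ | ⟨rfl, rfl⟩
        · rw [hs] at hf; cases hf
        · exact h.asymm _ _ hxy hd
      simp only [c, if_neg this, bcol]; simp
  have key : ∀ u ∈ K, ∀ v ∈ K, u ≠ v → PP G c K u v (bcol (s u)) (bcol (!s v)) := by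
    intro u hu v hv huv
    obtain ⟨p, hp, hd⟩ := exists_path_of_rtg (fun x y h' => (h.sub x y h').1) (h.conn u hu v hv)
    obtain ⟨h1, h2⟩ := walk_alt hc p hd
    have hne : p.edges ≠ [] := by
      cases p with
      | nil => exact absurd rfl huv
      | cons _ _ => simp
    refine ⟨p, hp, h1, ?_, (h2 hne).1, (h2 hne).2⟩
    intro x hx
    rw [← SimpleGraph.Walk.cons_map_snd_darts, List.mem_cons] at hx
    rcases hx with rfl | hx
    · exact hu
    · obtain ⟨d, hd', rfl⟩ := List.mem_map.1 hx
      exact (h.sub _ _ (hd d hd')).2.2.2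
  refine ⟨c, fun e => ?_, fun u hu v hv huv => ⟨key u hu v hv huv, (key v hv u hu huv.symm).symm⟩⟩
  simp only [c]; split_ifs <;> omega

theorem Strong.good {V : Type*} [DecidableEq V] {G : SimpleGraph V} {s : V → Bool} {K : Set V}
    {D : V → V → Prop} (h : Strong G s K D) (a b : V) :
    Good G K (fun v => 1 + (if v = a then 1 else 0) + (if v = b then 1 else 0)) := by
  obtain ⟨c, hc, hpp⟩ := h.exists_PP
  let γ : ℕ := if s a = s b then 1 else 0
  let T : V → Finset ℕ := fun v =>
    insert 2 ((if v = a then {0} else ∅) ∪ (if v = b then {γ} else ∅))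
  have hγ : γ < 2 := by simp only [γ]; split_ifs <;> omega
  refine ⟨c, T, hc, ?_, ?_, ?_, ?_, ?_⟩
  · intro v x hx
    simp only [T, Finset.mem_insert, Finset.mem_union] at hx
    rw [Finset.mem_range]
    rcases hx with rfl | hx | hx
    · omega
    · split_ifs at hx <;> simp at hx; omega
    · split_ifs at hx <;> simp at hx; omega
  · intro v
    by_cases h1 : v = a <;> by_cases h2 : v = b
    · have : γ = 1 := by simp [γ, ← h1, ← h2]
      simp only [T, if_pos h1, if_pos h2, this]; decide
    · simp [T, h1, h1 ▸ h2]
    · have : γ ≠ 2 := by omega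
      simp [T, h2, h2 ▸ h1, Finset.card_insert_of_notMem, this.symm]
    · simp [T, h1, h2]
  · intro u hu v hv huv; exact ⟨_, _, (hpp u hu v hv huv).1⟩
  · intro u hu δ hδ v hv huv
    obtain ⟨h1, h2⟩ := hpp u hu v hv huv.symm
    by_cases hd : bcol (s u) = δ
    · refine ⟨_, _, ?_, h2⟩
      rw [← hd]; cases s u <;> simp [bcol]
    · exact ⟨_, _, hd, h1⟩
  · intro u hu δ hδ v hv ε hε huv
    obtain ⟨h1, h2⟩ := hpp u hu v hv huv.symm
    have mem : ∀ v x, x ∈ T v → x = 2 ∨ (v = a ∧ x = 0) ∨ (v = b ∧ x = γ) := by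
      intro v x hx
      simp only [T, Finset.mem_insert, Finset.mem_union] at hx
      rcases hx with rfl | hx | hx
      · simp
      · split_ifs at hx with h3 <;> simp at hx; simp [h3, hx]
      · split_ifs at hx with h3 <;> simp at hx; simp [h3, hx]
    have goal : (bcol (s u) ≠ δ ∧ bcol (!s v) ≠ ε) ∨ (bcol (!s u) ≠ δ ∧ bcol (s v) ≠ ε) := by
      rcases mem u δ hδ with rfl | ⟨rfl, rfl⟩ | ⟨rfl, rfl⟩ <;>
      rcases mem v ε hε with rfl | ⟨rfl, rfl⟩ | ⟨rfl, rfl⟩ <;>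
      first
      | exact absurd rfl huv
      | (simp only [γ, bcol]; cases s u <;> cases s v <;> simp)
    rcases goal with ⟨g1, g2⟩ | ⟨g1, g2⟩
    · exact ⟨_, _, g1, g2, h1⟩
    · exact ⟨_, _, g1, g2, h2⟩

/-- special state: `w` has two neighbours in `K`. -/
theorem Strong.good_special {V : Type*} [DecidableEq V] {G : SimpleGraph V} {s : V → Bool}
    {K : Set V} {D : V → V → Prop} (h : Strong G s K D) {w x x' : V} (hw : w ∉ K) (hx : x ∈ K)
    (hx' : x' ∈ K) (hne : x ≠ x') (h1 : G.Adj w x) (h2 : G.Adj w x') :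
    Good G (insert w K) (fun v => if v = w then 3 else 0) := by
  obtain ⟨c, hc, hpp⟩ := h.exists_PP
  set c' : Sym2 V → ℕ := fun e => if e = s(w, x) then 2 else if e = s(w, x') then 0 else c e with hc'
  have hwx : w ≠ x := fun h => hw (h ▸ hx)
  have hwx' : w ≠ x' := fun h => hw (h ▸ hx')
  have c1 : c' s(w, x) = 2 := by simp [hc']
  have c2 : c' s(w, x') = 0 := by
    have : s(w, x') ≠ s(w, x) := by simp [hne.symm, hwx]
    simp [hc', this]
  have hagree : ∀ u ∈ K, ∀ v ∈ K, c' s(u, v) = c s(u, v) := by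
    intro u hu v hv
    have e1 : s(u, v) ≠ s(w, x) := by
      intro h
      rcases Sym2.eq_iff.1 h with ⟨rfl, rfl⟩ | ⟨rfl, rfl⟩ <;> contradiction
    have e2 : s(u, v) ≠ s(w, x') := by
      intro h
      rcases Sym2.eq_iff.1 h with ⟨rfl, rfl⟩ | ⟨rfl, rfl⟩ <;> contradiction
    simp [hc', e1, e2]
  have via2 : ∀ z ∈ K, ∃ β, PP G c' (insert w K) w z 2 β := by
    intro z hz
    by_cases hzx : z = x
    · subst hzx
      have := PP.edge (c := c') (S := insert w K) h1 (Set.mem_insert _ _) (Set.mem_insert_of_mem _ hx)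
      rw [c1] at this; exact ⟨_, this⟩
    · have := PP.cons (c := c') h1 hw (((hpp x hx z hz (Ne.symm hzx)).1).mono (le_refl K) hagree)
        (by rw [c1]; cases s x <;> simp [bcol])
      rw [c1] at this; exact ⟨_, this⟩
  have via0 : ∀ z ∈ K, ∃ β, PP G c' (insert w K) w z 0 β := by
    intro z hz
    by_cases hzx : z = x'
    · subst hzx
      have := PP.edge (c := c') (S := insert w K) h2 (Set.mem_insert _ _) (Set.mem_insert_of_mem _ hx')
      rw [c2] at this; exact ⟨_, this⟩
    · obtain ⟨p1, p2⟩ := hpp x' hx' z hz (Ne.symm hzx)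
      have : ∃ β, PP G c K x' z 1 β := by
        cases hs : s x' with
        | false => rw [hs] at p1; exact ⟨_, p1⟩
        | true => rw [hs] at p2; exact ⟨_, p2⟩
      obtain ⟨β, p⟩ := this
      have := PP.cons (c := c') h2 hw (p.mono (le_refl K) hagree) (by rw [c2]; simp)
      rw [c2] at this; exact ⟨_, this⟩
  refine ⟨c', fun v => if v = w then Finset.range 3 else ∅, ?_, ?_, ?_, ?_, ?_, ?_⟩
  · intro e; simp only [hc']; split_ifs
    · omega
    · omega
    · exact hc e
  · intro v; dsimp only; split_ifs <;> simp
  · intro v; dsimp only; split_ifs <;> simp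
  · intro u hu v hv huv
    rcases hu with rfl | hu <;> rcases hv with rfl | hv
    · exact absurd rfl huv
    · obtain ⟨β, h⟩ := via0 v hv; exact ⟨_, _, h⟩
    · obtain ⟨β, h⟩ := via0 u hu; exact ⟨_, _, h.symm⟩
    · exact ⟨_, _, ((hpp u hu v hv huv).1).mono (Set.subset_insert _ _) hagree⟩
  · intro u hu δ hδ v hv huv
    by_cases huw : u = w
    · subst huw
      have hv : v ∈ K := by rcases hv with rfl | hv; exacts [absurd rfl huv, hv]
      by_cases hd : δ = 2
      · obtain ⟨β, h⟩ := via0 v hv; exact ⟨_, _, by omega, h⟩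
      · obtain ⟨β, h⟩ := via2 v hv; exact ⟨_, _, Ne.symm hd, h⟩
    · simp [huw] at hδ
  · intro u hu δ hδ v hv ε hε huv
    by_cases huw : u = w
    · have : v ≠ w := fun h => huv (h.trans huw.symm)
      simp [this] at hε
    · simp [huw] at hδ

set_option maxHeartbeats 4000000 in
theorem finish4 {V : Type*} {G : SimpleGraph V} {s : V → Bool}
    {K : Set V} {D : V → V → Prop} (h : Strong G s K D) {w1 w2 w3 w4 p1 p2 p3 p4 : V}
    (hw1 : w1 ∉ K) (hw2 : w2 ∉ K) (hw3 : w3 ∉ K) (hw4 : w4 ∉ K)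
    (h12 : w1 ≠ w2) (h13 : w1 ≠ w3) (h14 : w1 ≠ w4) (h23 : w2 ≠ w3) (h24 : w2 ≠ w4) (h34 : w3 ≠ w4)
    (hall : ∀ v, v ∈ K ∨ v = w1 ∨ v = w2 ∨ v = w3 ∨ v = w4)
    (hp1 : p1 ∈ K) (hp2 : p2 ∈ K ∨ p2 = w1) (hp3 : p3 ∈ K ∨ p3 = w1 ∨ p3 = w2)
    (hp4 : p4 ∈ K ∨ p4 = w1 ∨ p4 = w2 ∨ p4 = w3)
    (a1 : G.Adj w1 p1) (a2 : G.Adj w2 p2) (a3 : G.Adj w3 p3) (a4 : G.Adj w4 p4)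
    (n1 : ¬ (p2 = p1 ∧ p3 = p1 ∧ p4 = p1)) (n2 : ¬ (p2 = w1 ∧ p3 = w1 ∧ p4 = w1)) :
    pc G ≤ 3 := by
  classical
  have main : ∀ a b : V, (p2 = p1 → p1 = a ∨ p1 = b) → 
      (p3 ∈ K → (p3 = p1 ∨ p3 = p2) → p3 = a ∨ p3 = b) → (p2 = p1 → p3 = p1 → p1 = a ∧ p1 = b) →
      (p4 ∈ K → (p4 = p1 ∨ p4 = p2 ∨ p4 = p3) → p4 = a ∨ p4 = b) →
      (p4 ∈ K → ((p4 = p1 ∧ p4 = p2) ∨ (p4 = p1 ∧ p4 = p3) ∨ (p4 = p2 ∧ p4 = p3)) → p4 = a ∧ p4 = b) →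
      pc G ≤ 3 := by
    intro a b e1 e2 e3 e4 e5
    have g0 := h.good a b
    have g1 := g0.step hp1 hw1 a1 (by omega)
    have g2 := g1.step (x := p2) (y := w2) (by rcases hp2 with h | rfl <;> simp [*])
      (by simp [h12.symm, hw2]) a2 (by grind)
    have g3 := g2.step (x := p3) (y := w3) (by rcases hp3 with h | rfl | rfl <;> simp [*])
      (by simp [h13.symm, h23.symm, hw3]) a3 (by grind)
    have g4 := g3.step (x := p4) (y := w4) (by rcases hp4 with h | rfl | rfl | rfl <;> simp [*])
      (by simp [h14.symm, h24.symm, h34.symm, hw4]) a4 (by clear g0 g1 g2 g3 a1 a2 a3 a4 hall h; rcases hp4 with h | h | h | h <;> grind)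
    have : (insert w4 (insert w3 (insert w2 (insert w1 K)))) = Set.univ := by
      exact Set.eq_univ_of_forall (fun v => by simp only [Set.mem_insert_iff]; have := hall v; clear * - this; tauto)
    rw [this] at g4
    exact g4.pc_le
  by_cases q21 : p2 = p1
  · by_cases q31 : p3 = p1
    · exact main p1 p1 (by grind) (by grind) (by grind) (by grind) (by grind)
    · exact main p1 p4 (by grind) (by grind) (by grind) (by grind) (by grind)
  · by_cases q3 : p3 ∈ K ∧ (p3 = p1 ∨ p3 = p2)
    · exact main p3 p4 (by grind) (by grind) (by grind) (by grind) (by grind)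
    · exact main p4 p4 (by grind) (by grind) (by grind) (by grind) (by grind)

theorem finish3 {V : Type*} {G : SimpleGraph V} {s : V → Bool}
    {K : Set V} {D : V → V → Prop} (h : Strong G s K D) {w1 w2 w3 p1 p2 p3 : V}
    (hw1 : w1 ∉ K) (hw2 : w2 ∉ K) (hw3 : w3 ∉ K)
    (h12 : w1 ≠ w2) (h13 : w1 ≠ w3) (h23 : w2 ≠ w3)
    (hall : ∀ v, v ∈ K ∨ v = w1 ∨ v = w2 ∨ v = w3)
    (hp1 : p1 ∈ K) (hp2 : p2 ∈ K ∨ p2 = w1) (hp3 : p3 ∈ K ∨ p3 = w1 ∨ p3 = w2)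
    (a1 : G.Adj w1 p1) (a2 : G.Adj w2 p2) (a3 : G.Adj w3 p3) : pc G ≤ 3 := by
  classical
  have g0 := h.good p2 p3
  have g1 := g0.step hp1 hw1 a1 (by omega)
  have g2 := g1.step (x := p2) (y := w2) (by rcases hp2 with h | rfl <;> simp [*])
      (by simp [h12.symm, hw2]) a2 (by grind)
  have g3 := g2.step (x := p3) (y := w3) (by rcases hp3 with h | rfl | rfl <;> simp [*])
      (by simp [h13.symm, h23.symm, hw3]) a3 (by grind)
  have : (insert w3 (insert w2 (insert w1 K))) = Set.univ := by
    exact Set.eq_univ_of_forall (fun v => by simp only [Set.mem_insert_iff]; have := hall v; clear * - this; tauto)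
  rw [this] at g3
  exact g3.pc_le

theorem finish2 {V : Type*} {G : SimpleGraph V} {s : V → Bool}
    {K : Set V} {D : V → V → Prop} (h : Strong G s K D) {w1 w2 p1 p2 : V}
    (hw1 : w1 ∉ K) (hw2 : w2 ∉ K) (h12 : w1 ≠ w2)
    (hall : ∀ v, v ∈ K ∨ v = w1 ∨ v = w2)
    (hp1 : p1 ∈ K) (hp2 : p2 ∈ K ∨ p2 = w1)
    (a1 : G.Adj w1 p1) (a2 : G.Adj w2 p2) : pc G ≤ 3 := by
  classical
  have g0 := h.good p2 p2
  have g1 := g0.step hp1 hw1 a1 (by omega)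
  have g2 := g1.step (x := p2) (y := w2) (by rcases hp2 with h | rfl <;> simp [*])
      (by simp [h12.symm, hw2]) a2 (by grind)
  have : (insert w2 (insert w1 K)) = Set.univ := by
    exact Set.eq_univ_of_forall (fun v => by simp only [Set.mem_insert_iff]; have := hall v; clear * - this; tauto)
  rw [this] at g2
  exact g2.pc_le

theorem finish1 {V : Type*} {G : SimpleGraph V} {s : V → Bool}
    {K : Set V} {D : V → V → Prop} (h : Strong G s K D) {w1 p1 : V}
    (hw1 : w1 ∉ K) (hall : ∀ v, v ∈ K ∨ v = w1)
    (hp1 : p1 ∈ K) (a1 : G.Adj w1 p1) : pc G ≤ 3 := by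
  classical
  have g0 := h.good p1 p1
  have g1 := g0.step hp1 hw1 a1 (by omega)
  have : (insert w1 K) = Set.univ := by
    exact Set.eq_univ_of_forall (fun v => by simp only [Set.mem_insert_iff]; have := hall v; clear * - this; tauto)
  rw [this] at g1
  exact g1.pc_le

theorem finish_special {V : Type*} {G : SimpleGraph V} {s : V → Bool}
    {K : Set V} {D : V → V → Prop} (h : Strong G s K D) {w1 w2 w3 w4 x x' : V}
    (hw1 : w1 ∉ K) (hw2 : w2 ∉ K) (hw3 : w3 ∉ K) (hw4 : w4 ∉ K)
    (h12 : w1 ≠ w2) (h13 : w1 ≠ w3) (h14 : w1 ≠ w4) (h23 : w2 ≠ w3) (h24 : w2 ≠ w4) (h34 : w3 ≠ w4)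
    (hall : ∀ v, v ∈ K ∨ v = w1 ∨ v = w2 ∨ v = w3 ∨ v = w4)
    (hx : x ∈ K) (hx' : x' ∈ K) (hne : x ≠ x') (a1 : G.Adj w1 x) (a1' : G.Adj w1 x')
    (a2 : G.Adj w2 w1) (a3 : G.Adj w3 w1) (a4 : G.Adj w4 w1) : pc G ≤ 3 := by
  classical
  have g1 := h.good_special hw1 hx hx' hne a1 a1'
  have g2 := g1.step (x := w1) (y := w2) (by simp)
      (by simp [h12.symm, hw2]) a2 (by simp)
  have g3 := g2.step (x := w1) (y := w3) (by simp)
      (by simp [h13.symm, h23.symm, hw3]) a3 (by simp [h12])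
  have g4 := g3.step (x := w1) (y := w4) (by simp)
      (by simp [h14.symm, h24.symm, h34.symm, hw4]) a4 (by simp [h12, h13])
  have : (insert w4 (insert w3 (insert w2 (insert w1 K)))) = Set.univ := by
    exact Set.eq_univ_of_forall (fun v => by simp only [Set.mem_insert_iff]; have := hall v; clear * - this; tauto)
  rw [this] at g4
  exact g4.pc_le

/-- all four outside vertices hang at `v`, plus an extra edge at `w1`. -/
theorem finishF1 {V : Type*} {G : SimpleGraph V} {s : V → Bool}
    {K : Set V} {D : V → V → Prop} (h : Strong G s K D) {w1 w2 w3 w4 v z : V}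
    (hw1 : w1 ∉ K) (hw2 : w2 ∉ K) (hw3 : w3 ∉ K) (hw4 : w4 ∉ K)
    (h12 : w1 ≠ w2) (h13 : w1 ≠ w3) (h14 : w1 ≠ w4) (h23 : w2 ≠ w3) (h24 : w2 ≠ w4) (h34 : w3 ≠ w4)
    (hall : ∀ v, v ∈ K ∨ v = w1 ∨ v = w2 ∨ v = w3 ∨ v = w4)
    (hv : v ∈ K) (a1 : G.Adj w1 v) (a2 : G.Adj w2 v) (a3 : G.Adj w3 v) (a4 : G.Adj w4 v)
    (hz : G.Adj w1 z) (hzv : z ≠ v) : pc G ≤ 3 := by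
  have n1 : w1 ≠ v := fun h => hw1 (h ▸ hv)
  rcases hall z with hz' | rfl | rfl | rfl | rfl
  · exact finish4 h hw1 hw2 hw3 hw4 h12 h13 h14 h23 h24 h34 hall hz' (Or.inl hv) (Or.inl hv)
      (Or.inl hv) hz a2 a3 a4 (fun h => hzv h.1.symm) (fun h => n1 h.1.symm)
  · exact absurd rfl hz.ne
  · exact finish4 (p2 := w1) h hw1 hw2 hw3 hw4 h12 h13 h14 h23 h24 h34 hall hv (Or.inr rfl) (Or.inl hv)
      (Or.inl hv) a1 hz.symm a3 a4 (fun h => n1 h.1) (fun h => n1 h.2.1.symm)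
  · exact finish4 (p2 := w1) h hw1 hw3 hw2 hw4 h13 h12 h14 h23.symm h34 h24 (by grind) hv (Or.inr rfl)
      (Or.inl hv) (Or.inl hv) a1 hz.symm a2 a4 (fun h => n1 h.1) (fun h => n1 h.2.1.symm)
  · exact finish4 (p2 := w1) h hw1 hw4 hw2 hw3 h14 h12 h13 h24.symm h34.symm h23 (by grind) hv (Or.inr rfl)
      (Or.inl hv) (Or.inl hv) a1 hz.symm a2 a3 (fun h => n1 h.1) (fun h => n1 h.2.1.symm)

/-- `w1` hangs at `v`, the others at `w1`, extra edge at `w2`. -/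
theorem finishF2 {V : Type*} {G : SimpleGraph V} {s : V → Bool}
    {K : Set V} {D : V → V → Prop} (h : Strong G s K D) {w1 w2 w3 w4 v z : V}
    (hw1 : w1 ∉ K) (hw2 : w2 ∉ K) (hw3 : w3 ∉ K) (hw4 : w4 ∉ K)
    (h12 : w1 ≠ w2) (h13 : w1 ≠ w3) (h14 : w1 ≠ w4) (h23 : w2 ≠ w3) (h24 : w2 ≠ w4) (h34 : w3 ≠ w4)
    (hall : ∀ v, v ∈ K ∨ v = w1 ∨ v = w2 ∨ v = w3 ∨ v = w4)
    (hv : v ∈ K) (a1 : G.Adj w1 v) (a2 : G.Adj w2 w1) (a3 : G.Adj w3 w1) (a4 : G.Adj w4 w1)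
    (hz : G.Adj w2 z) (hzv : z ≠ w1) : pc G ≤ 3 := by
  have n1 : w1 ≠ v := fun h => hw1 (h ▸ hv)
  rcases hall z with hz' | rfl | rfl | rfl | rfl
  · exact finish4 (p3 := w1) (p4 := w1) h hw1 hw2 hw3 hw4 h12 h13 h14 h23 h24 h34 hall hv (Or.inl hz')
      (Or.inr (Or.inl rfl)) (Or.inr (Or.inl rfl)) a1 hz a3 a4 (fun h => n1 h.2.1) (fun h => hzv h.1)
  · exact absurd rfl hzv
  · exact absurd rfl hz.ne
  · exact finish4 (p2 := w1) (p3 := w2) (p4 := w1) h hw1 hw2 hw3 hw4 h12 h13 h14 h23 h24 h34 hall hv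
      (Or.inr rfl) (Or.inr (Or.inr rfl)) (Or.inr (Or.inl rfl)) a1 a2 hz.symm a4 (fun h => n1 h.1)
      (fun h => h12 h.2.1.symm)
  · exact finish4 (p2 := w1) (p3 := w2) (p4 := w1) h hw1 hw2 hw4 hw3 h12 h14 h13 h24 h23 h34.symm
      (by grind) hv
      (Or.inr rfl) (Or.inr (Or.inr rfl)) (Or.inr (Or.inl rfl)) a1 a2 hz.symm a3 (fun h => n1 h.1)
      (fun h => h12 h.2.1.symm)

theorem exists_ext {V : Type*} {G : SimpleGraph V} (hconn : G.Connected) {S : Set V}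
    (h1 : S.Nonempty) (h2 : S ≠ Set.univ) : ∃ y x, y ∉ S ∧ x ∈ S ∧ G.Adj y x := by
  obtain ⟨u, hu⟩ := h1
  obtain ⟨v, hv⟩ := (Set.ne_univ_iff_exists_notMem S).1 h2
  obtain ⟨p⟩ := hconn.preconnected u v
  obtain ⟨d, -, h1, h2⟩ := p.exists_boundary_dart S hu hv
  exact ⟨_, _, h2, h1, d.adj.symm⟩

set_option maxHeartbeats 1000000 in
theorem combine {V : Type*} [Finite V] {G : SimpleGraph V} {s : V → Bool}
    {K : Set V} {D : V → V → Prop} (h : Strong G s K D) (hK : K.Nonempty) (hconn : G.Connected)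
    (hcard : Kᶜ.ncard ≤ 4)
    (hextra : Kᶜ.ncard = 4 → ∀ L : Finset (Sym2 V), L.card ≤ 4 →
      ∃ u, u ∉ K ∧ ∃ z, G.Adj u z ∧ s(u, z) ∉ L) : pc G ≤ 3 := by
  classical
  by_cases e0 : K = Set.univ
  · have v := hK.choose
    have := h.good v v
    rw [e0] at this; exact this.pc_le
  obtain ⟨w1, p1, hw1, hp1, a1⟩ := exists_ext hconn hK e0
  by_cases e1 : insert w1 K = Set.univ
  · exact finish1 h hw1 (fun v => by have : v ∈ insert w1 K := e1 ▸ trivial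
                                     simpa [or_comm] using this) hp1 a1
  obtain ⟨w2, p2, hw2, hp2, a2⟩ := exists_ext hconn (Set.insert_nonempty _ _) e1
  simp only [Set.mem_insert_iff, not_or] at hw2 hp2
  by_cases e2 : insert w2 (insert w1 K) = Set.univ
  · exact finish2 h hw1 hw2.2 (Ne.symm hw2.1)
      (fun v => by have : v ∈ insert w2 (insert w1 K) := e2 ▸ trivial
                   simp only [Set.mem_insert_iff] at this; clear * - this; tauto) hp1 hp2.symm a1 a2
  obtain ⟨w3, p3, hw3, hp3, a3⟩ := exists_ext hconn (Set.insert_nonempty _ _) e2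
  simp only [Set.mem_insert_iff, not_or] at hw3 hp3
  have hp3' : p3 ∈ K ∨ p3 = w1 ∨ p3 = w2 := by clear * - hp3; tauto
  by_cases e3 : insert w3 (insert w2 (insert w1 K)) = Set.univ
  · exact finish3 h hw1 hw2.2 hw3.2.2 (Ne.symm hw2.1) (Ne.symm hw3.2.1) (Ne.symm hw3.1)
      (fun v => by have : v ∈ insert w3 (insert w2 (insert w1 K)) := e3 ▸ trivial
                   simp only [Set.mem_insert_iff] at this; clear * - this; tauto) hp1 hp2.symm hp3' a1 a2 a3
  obtain ⟨w4, p4, hw4, hp4, a4⟩ := exists_ext hconn (Set.insert_nonempty _ _) e3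
  simp only [Set.mem_insert_iff, not_or] at hw4 hp4
  have hp4' : p4 ∈ K ∨ p4 = w1 ∨ p4 = w2 ∨ p4 = w3 := by clear * - hp4; tauto
  obtain ⟨h12, hw2⟩ := hw2
  obtain ⟨h23, h13, hw3⟩ := hw3
  obtain ⟨h34, h24, h14, hw4⟩ := hw4
  replace h12 := Ne.symm h12
  replace h23 := Ne.symm h23
  replace h13 := Ne.symm h13
  replace h34 := Ne.symm h34
  replace h24 := Ne.symm h24
  replace h14 := Ne.symm h14
  have hsub : ((({w1, w2, w3, w4} : Finset V)) : Set V) ⊆ Kᶜ := by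
    intro v hv
    simp at hv
    rcases hv with rfl | rfl | rfl | rfl <;> assumption
  have hc4 : ((({w1, w2, w3, w4} : Finset V)) : Set V).ncard = 4 := by
    rw [Set.ncard_coe_finset]
    simp [h12, h13, h14, h23, h24, h34]
  have hle := Set.ncard_le_ncard hsub (Set.toFinite _)
  have hK4 : Kᶜ.ncard = 4 := by omega
  have heq := Set.eq_of_subset_of_ncard_le hsub (by omega) (Set.toFinite _)
  have hall : ∀ v, v ∈ K ∨ v = w1 ∨ v = w2 ∨ v = w3 ∨ v = w4 := by
    intro v
    by_cases hv : v ∈ K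
    · exact Or.inl hv
    · have : v ∈ Kᶜ := hv
      rw [← heq] at this
      simp at this
      exact Or.inr this
  replace hextra := hextra hK4
  by_cases n1 : p2 = p1 ∧ p3 = p1 ∧ p4 = p1
  · obtain ⟨rfl, rfl, rfl⟩ := n1
    obtain ⟨u, hu, z, hz, hL⟩ := hextra {s(w1, p4), s(w2, p4), s(w3, p4), s(w4, p4)} Finset.card_le_four
    have hzv : z ≠ p4 := by
      rintro rfl
      apply hL
      rcases hall u with h | rfl | rfl | rfl | rfl
      · exact absurd h hu
      all_goals simp
    rcases hall u with h' | rfl | rfl | rfl | rfl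
    · exact absurd h' hu
    · exact finishF1 h hw1 hw2 hw3 hw4 h12 h13 h14 h23 h24 h34 hall hp1 a1 a2 a3 a4 hz hzv
    · exact finishF1 h hw2 hw1 hw3 hw4 h12.symm h23 h24 h13 h14 h34 (by clear * - hall; grind) hp1 a2 a1 a3 a4 hz hzv
    · exact finishF1 h hw3 hw1 hw2 hw4 h13.symm h23.symm h34 h12 h14 h24 (by clear * - hall; grind) hp1 a3 a1 a2 a4 hz hzv
    · exact finishF1 h hw4 hw1 hw2 hw3 h14.symm h24.symm h34.symm h12 h13 h23 (by clear * - hall; grind) hp1 a4 a1 a2 a3 hz hzv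
  by_cases n2 : p2 = w1 ∧ p3 = w1 ∧ p4 = w1
  · obtain ⟨r2, r3, r4⟩ := n2
    rw [r2] at a2
    rw [r3] at a3
    rw [r4] at a4
    obtain ⟨u, hu, z, hz, hL⟩ := hextra {s(w1, p1), s(w2, w1), s(w3, w1), s(w4, w1)} Finset.card_le_four
    have hzv : u ≠ w1 → z ≠ w1 := by
      rintro hu1 rfl
      apply hL
      rcases hall u with h | rfl | rfl | rfl | rfl
      · exact absurd h hu
      · exact absurd rfl hu1
      all_goals simp
    rcases hall u with h' | rfl | rfl | rfl | rfl
    · exact absurd h' hu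
    · have hzp : p1 ≠ z := by rintro rfl; simp at hL
      have hzK : z ∈ K := by
        rcases hall z with h | rfl | rfl | rfl | rfl
        · exact h
        · exact absurd rfl hz.ne
        all_goals (exfalso; apply hL; simp [Sym2.eq_swap])
      exact finish_special h hw1 hw2 hw3 hw4 h12 h13 h14 h23 h24 h34 hall hp1 hzK hzp a1 hz a2 a3 a4
    · exact finishF2 h hw1 hw2 hw3 hw4 h12 h13 h14 h23 h24 h34 hall hp1 a1 a2 a3 a4 hz (hzv h12.symm)
    · exact finishF2 h hw1 hw3 hw2 hw4 h13 h12 h14 h23.symm h34 h24 (by clear * - hall; grind) hp1 a1 a3 a2 a4 hz (hzv h13.symm)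
    · exact finishF2 h hw1 hw4 hw2 hw3 h14 h12 h13 h24.symm h34.symm h23 (by clear * - hall; grind) hp1 a1 a4 a2 a3 hz (hzv h14.symm)
  exact finish4 h hw1 hw2 hw3 hw4 h12 h13 h14 h23 h24 h34 hall hp1 hp2.symm hp3' hp4' a1 a2 a3 a4 n1 n2

theorem walk_rtg {V : Type*} {G : SimpleGraph V} {x y : V} (p : G.Walk x y) :
    ∀ z ∈ p.support,
      Relation.ReflTransGen (fun u v => ∃ d ∈ p.darts, d.fst = u ∧ d.snd = v) x z ∧
      Relation.ReflTransGen (fun u v => ∃ d ∈ p.darts, d.fst = u ∧ d.snd = v) z y := by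
  induction p with
  | nil => intro z hz; simp at hz; subst hz; exact ⟨.refl, .refl⟩
  | @cons u w v h p ih =>
    have mono : ∀ a b, Relation.ReflTransGen (fun u v => ∃ d ∈ p.darts, d.fst = u ∧ d.snd = v) a b →
        Relation.ReflTransGen (fun u v => ∃ d ∈ (SimpleGraph.Walk.cons h p).darts, d.fst = u ∧ d.snd = v) a b := by
      intro a b hab
      refine Relation.ReflTransGen.mono ?_ _ _ hab
      rintro u v ⟨d, hd, h1⟩
      exact ⟨d, by simp [hd], h1⟩
    have first : Relation.ReflTransGen (fun u v => ∃ d ∈ (SimpleGraph.Walk.cons h p).darts, d.fst = u ∧ d.snd = v) u w :=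
      .single ⟨⟨(u, w), h⟩, by simp, rfl, rfl⟩
    intro z hz
    rw [SimpleGraph.Walk.support_cons] at hz
    rcases List.mem_cons.1 hz with rfl | hz
    · exact ⟨.refl, first.trans (mono _ _ (ih w (by simp)).2)⟩
    · exact ⟨first.trans (mono _ _ (ih z hz).1), mono _ _ (ih z hz).2⟩

theorem path_asymm {V : Type*} {G : SimpleGraph V} {x y : V} (p : G.Walk x y) (hp : p.IsPath) :
    ∀ d ∈ p.darts, ∀ e ∈ p.darts, d.fst = e.snd → d.snd = e.fst → False := by
  induction p with
  | nil => intro d hd; simp at hd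
  | @cons u w v h p ih =>
    rw [SimpleGraph.Walk.cons_isPath_iff] at hp
    intro d hd e he h1 h2
    rw [SimpleGraph.Walk.darts_cons, List.mem_cons] at hd he
    rcases hd with rfl | hd <;> rcases he with rfl | he
    · exact h.ne h1
    · apply hp.2; simp at h1; rw [h1]; exact p.dart_snd_mem_support_of_mem_darts he
    · apply hp.2; simp at h2; rw [← h2]; exact p.dart_snd_mem_support_of_mem_darts hd
    · exact ih hp.1 d hd e he h1 h2

theorem Strong.ear {V : Type*} {G : SimpleGraph V} {s : V → Bool}
    {K : Set V} {D : V → V → Prop} (h : Strong G s K D) {a b x y : V} (ha : a ∈ K) (hb : b ∈ K)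
    (hx : x ∉ K) (hy : y ∉ K) (hxa : G.Adj x a) (sxa : s x ≠ s a) (hyb : G.Adj y b) (syb : s y ≠ s b)
    (hne : ¬ (x = y ∧ a = b))
    (hxy : Relation.ReflTransGen (fun u v => G.Adj u v ∧ s u ≠ s v ∧ u ∉ K ∧ v ∉ K) x y) :
    ∃ K' D', Strong G s K' D' ∧ K ⊂ K' := by
  obtain ⟨p, hp, hd⟩ := exists_path_of_rtg (fun _ _ h => h.1) hxy
  have hsupp : ∀ z ∈ p.support, z ∉ K := by
    intro z hz
    rw [← SimpleGraph.Walk.cons_map_snd_darts, List.mem_cons] at hz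
    rcases hz with rfl | hz
    · exact hx
    · obtain ⟨d, hd', rfl⟩ := List.mem_map.1 hz
      exact (hd d hd').2.2.2
  let P : V → V → Prop := fun u v => ∃ d ∈ p.darts, d.fst = u ∧ d.snd = v
  let D' : V → V → Prop := fun u v => D u v ∨ (u = a ∧ v = x) ∨ (u = y ∧ v = b) ∨ P u v
  have hP : ∀ u v, P u v → G.Adj u v ∧ s u ≠ s v ∧ u ∈ p.support ∧ v ∈ p.support ∧ u ∉ K ∧ v ∉ K := by
    rintro u v ⟨d, hd', rfl, rfl⟩
    obtain ⟨h1, h2, h3, h4⟩ := hd d hd'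
    exact ⟨h1, h2, p.dart_fst_mem_support_of_mem_darts hd', p.dart_snd_mem_support_of_mem_darts hd', h3, h4⟩
  refine ⟨K ∪ {z | z ∈ p.support}, D', ⟨?_, ?_, ?_⟩, ?_⟩
  · rintro u v (h1 | ⟨rfl, rfl⟩ | ⟨rfl, rfl⟩ | h1)
    · obtain ⟨h2, h3, h4, h5⟩ := h.sub u v h1
      exact ⟨h2, h3, Or.inl h4, Or.inl h5⟩
    · exact ⟨hxa.symm, sxa.symm, Or.inl ha, Or.inr (by simp)⟩
    · exact ⟨hyb, syb, Or.inr (by simp), Or.inl hb⟩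
    · obtain ⟨h2, h3, h4, h5, -⟩ := hP u v h1
      exact ⟨h2, h3, Or.inr h4, Or.inr h5⟩
  · have hPP : ∀ u v, P u v → P v u → False := by
      rintro u v ⟨d, hd, rfl, rfl⟩ ⟨e, he, h1, h2⟩
      exact path_asymm p hp d hd e he h2.symm h1.symm
    intro u v h1 h2
    have A := h.asymm
    have B := h.sub
    rcases h1 with h1 | h1 | h1 | h1 <;> rcases h2 with h2 | h2 | h2 | h2
    · exact A _ _ h1 h2
    all_goals first
      | exact hPP _ _ h1 h2
      | (have C := B _ _ h1; grind)
      | (have C := B _ _ h2; grind)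
      | (have C := hP _ _ h1; grind)
      | (have C := hP _ _ h2; grind)
      | grind
  · have liftD : ∀ {u v}, Relation.ReflTransGen D u v → Relation.ReflTransGen D' u v :=
      fun h => Relation.ReflTransGen.mono (fun _ _ h => Or.inl h) _ _ h
    have liftP : ∀ {u v}, Relation.ReflTransGen P u v → Relation.ReflTransGen D' u v :=
      fun h => Relation.ReflTransGen.mono (fun _ _ h => Or.inr (Or.inr (Or.inr h))) _ _ h
    have hax : Relation.ReflTransGen D' a x := .single (Or.inr (Or.inl ⟨rfl, rfl⟩))
    have hyb' : Relation.ReflTransGen D' y b := .single (Or.inr (Or.inr (Or.inl ⟨rfl, rfl⟩)))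
    have key : ∀ u ∈ K ∪ {z | z ∈ p.support},
        Relation.ReflTransGen D' u a ∧ Relation.ReflTransGen D' a u := by
      rintro u (hu | hu)
      · exact ⟨liftD (h.conn u hu a ha), liftD (h.conn a ha u hu)⟩
      · obtain ⟨h1, h2⟩ := walk_rtg p u hu
        exact ⟨((liftP h2).trans hyb').trans (liftD (h.conn b hb a ha)), hax.trans (liftP h1)⟩
    intro u hu v hv
    exact (key u hu).1.trans (key v hv).2
  · refine ⟨Set.subset_union_left, fun hsub => hx (hsub (Or.inr (by simp)))⟩

def FF {V : Type*} (f : V → V → ℕ) (X Y : Finset V) : ℕ := ∑ u ∈ X, ∑ w ∈ Y, f u w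

theorem FF_comm {V : Type*} {f : V → V → ℕ} (hf : ∀ u w, f u w = f w u) (X Y : Finset V) :
    FF f X Y = FF f Y X := by
  unfold FF
  rw [Finset.sum_comm]
  exact Finset.sum_congr rfl fun u _ => Finset.sum_congr rfl fun w _ => hf _ _

theorem FF_union {V : Type*} [DecidableEq V] {f : V → V → ℕ} (hf : ∀ u w, f u w = f w u)
    {X Y : Finset V} (h : Disjoint X Y) :
    FF f (X ∪ Y) (X ∪ Y) = FF f X X + FF f Y Y + 2 * FF f X Y := by
  have h1 := FF_comm hf X Y
  have h2 : FF f (X ∪ Y) (X ∪ Y) = FF f X X + FF f X Y + (FF f Y X + FF f Y Y) := by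
    unfold FF
    rw [Finset.sum_union h]
    simp only [Finset.sum_union h, Finset.sum_add_distrib]
  omega

theorem FF_mono {V : Type*} {f : V → V → ℕ} {X Y X' Y' : Finset V} (h : X ⊆ X') (h' : Y ⊆ Y') :
    FF f X Y ≤ FF f X' Y' := by
  unfold FF
  calc _ ≤ ∑ u ∈ X, ∑ w ∈ Y', f u w :=
        Finset.sum_le_sum fun u _ => Finset.sum_le_sum_of_subset h'
    _ ≤ _ := Finset.sum_le_sum_of_subset h

open Classical in
noncomputable def adjN {V : Type*} (G : SimpleGraph V) (u w : V) : ℕ := if G.Adj u w then 1 else 0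

open Classical in
noncomputable def biN {V : Type*} (G : SimpleGraph V) (s : V → Bool) (u w : V) : ℕ :=
  if G.Adj u w ∧ s u ≠ s w then 1 else 0

theorem adjN_comm {V : Type*} (G : SimpleGraph V) (u w : V) : adjN G u w = adjN G w u := by
  unfold adjN
  classical exact if_congr (G.adj_comm u w) rfl rfl

theorem biN_comm {V : Type*} (G : SimpleGraph V) (s : V → Bool) (u w : V) :
    biN G s u w = biN G s w u := by
  unfold biN
  classical exact if_congr (and_congr (G.adj_comm u w) ne_comm) rfl rfl

theorem FF_adj_le {V : Type*} (G : SimpleGraph V) (X : Finset V) :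
    FF (adjN G) X X + X.card ≤ X.card * X.card := by
  classical
  unfold FF
  have : ∀ u ∈ X, (∑ w ∈ X, adjN G u w) + 1 ≤ X.card := by
    intro u hu
    rw [← Finset.sum_erase_add _ _ hu]
    have h1 : adjN G u u = 0 := by simp [adjN]
    have h2 : ∑ w ∈ X.erase u, adjN G u w ≤ ∑ w ∈ X.erase u, 1 :=
      Finset.sum_le_sum fun w _ => by unfold adjN; split_ifs <;> simp
    have h3 := Finset.card_erase_add_one hu
    simp at h2
    have : 0 < X.card := Finset.card_pos.2 ⟨u, hu⟩
    omega
  have h := Finset.sum_le_sum this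
  simpa [Finset.sum_add_distrib] using h

theorem FF_adj_univ {V : Type*} [Fintype V] (G : SimpleGraph V) :
    FF (adjN G) Finset.univ Finset.univ = 2 * G.edgeSet.ncard := by
  classical
  have := G.sum_degrees_eq_twice_card_edges
  rw [Set.ncard_eq_toFinset_card', ← SimpleGraph.edgeFinset, ← this]
  unfold FF adjN
  refine Finset.sum_congr rfl fun u _ => ?_
  rw [← SimpleGraph.card_neighborFinset_eq_degree, SimpleGraph.neighborFinset_eq_filter]
  simp

theorem exists_maxcut {V : Type*} [Fintype V] [DecidableEq V] (G : SimpleGraph V) :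
    ∃ s : V → Bool, ∀ C : Finset V, FF (biN G s) C Cᶜ ≤ 1 → FF (adjN G) C Cᶜ ≤ 2 := by
  obtain ⟨s, hs⟩ := Finite.exists_max
    (fun s : V → Bool => FF (biN G s) Finset.univ Finset.univ)
  refine ⟨s, fun C hC => ?_⟩
  let s' : V → Bool := fun v => if v ∈ C then !s v else s v
  have h := hs s'
  rw [← Finset.union_compl C, FF_union (biN_comm G _) disjoint_compl_right,
    FF_union (biN_comm G _) disjoint_compl_right] at h
  have e1 : FF (biN G s') C C = FF (biN G s) C C := by
    refine Finset.sum_congr rfl fun u hu => Finset.sum_congr rfl fun w hw => ?_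
    unfold biN
    classical exact if_congr (and_congr Iff.rfl (by simp [s', hu, hw])) rfl rfl
  have e2 : FF (biN G s') Cᶜ Cᶜ = FF (biN G s) Cᶜ Cᶜ := by
    refine Finset.sum_congr rfl fun u hu => Finset.sum_congr rfl fun w hw => ?_
    rw [Finset.mem_compl] at hu hw
    unfold biN
    classical exact if_congr (and_congr Iff.rfl (by simp [s', hu, hw])) rfl rfl
  have e3 : FF (biN G s') C Cᶜ + FF (biN G s) C Cᶜ = FF (adjN G) C Cᶜ := by
    unfold FF
    rw [← Finset.sum_add_distrib]
    refine Finset.sum_congr rfl fun u hu => ?_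
    rw [← Finset.sum_add_distrib]
    refine Finset.sum_congr rfl fun w hw => ?_
    rw [Finset.mem_compl] at hw
    by_cases ha : G.Adj u w <;> cases h1 : s u <;> cases h2 : s w <;>
      simp [biN, adjN, s', hu, hw, ha, h1, h2]
  omega

theorem exists_W {V : Type*} [Fintype V] [DecidableEq V] (G : SimpleGraph V)
    (hn : 15 ≤ Fintype.card V)
    (hm : (Fintype.card V - 4) * (Fintype.card V - 5) + 10 ≤ FF (adjN G) Finset.univ Finset.univ) :
    ∃ W : Finset V, W.card ≤ 4 ∧ ∀ S : Finset V, S.card ≤ 4 →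
      FF (adjN G) S Sᶜ ≤ 2 → S ⊆ W := by
  classical
  let P : Finset V → Prop := fun W =>
    FF (adjN G) Finset.univ Finset.univ ≤ FF (adjN G) Wᶜ Wᶜ + 4 * W.card
  obtain ⟨W, hW, hmax⟩ := Finset.exists_max_image (Finset.univ.filter P) Finset.card
    ⟨∅, by simp [P]⟩
  have hP : P W := (Finset.mem_filter.1 hW).2
  refine ⟨W, ?_, ?_⟩
  · by_contra hw
    have h1 := FF_adj_le G Wᶜ
    have h2 := Finset.card_compl_add_card W
    simp only [P] at hP
    obtain ⟨m, hm'⟩ := Nat.exists_eq_add_of_le hn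
    rw [hm'] at hm h2
    have e1 : 15 + m - 4 = m + 11 := by omega
    have e2 : 15 + m - 5 = m + 10 := by omega
    rw [e1, e2] at hm
    generalize Wᶜ.card = k at *
    generalize W.card = w at *
    obtain ⟨j, rfl⟩ : ∃ j, w = j + 5 := ⟨w - 5, by omega⟩
    have : k + j = m + 10 := by omega
    nlinarith [Nat.zero_le (k*j)]
  · intro S hS hcut
    by_contra hSW
    set T := S \ W with hT
    have hTne : T.Nonempty := Finset.sdiff_nonempty.2 hSW
    have hd : Disjoint W T := Finset.disjoint_sdiff
    have hcard : (W ∪ T).card = W.card + T.card := Finset.card_union_of_disjoint hd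
    have hTc : 0 < T.card := hTne.card_pos
    have hT4 : T.card ≤ 4 := (Finset.card_le_card Finset.sdiff_subset).trans hS
    have hnot : ¬ P (W ∪ T) := by
      intro hp
      have := hmax (W ∪ T) (by simp [hp])
      omega
    apply hnot
    have e : Wᶜ = T ∪ (W ∪ T)ᶜ := by
      ext v; simp [hT]; tauto
    simp only [P] at hP ⊢
    have hdis : Disjoint T (W ∪ T)ᶜ := by
      rw [Finset.disjoint_left]; intro v hv; simp [hv]
    rw [e, FF_union (adjN_comm G) hdis] at hP
    have h1 := FF_adj_le G T
    have h2 : FF (adjN G) T (W ∪ T)ᶜ ≤ FF (adjN G) S Sᶜ := by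
      apply FF_mono Finset.sdiff_subset
      intro v; simp [hT]
    rw [hcard]
    generalize T.card = d at *
    interval_cases d <;> omega

theorem final_aux {V : Type*} [Fintype V] [DecidableEq V] (G : SimpleGraph V)
    (hn : 15 ≤ Fintype.card V)
    (hm : (Fintype.card V - 4) * (Fintype.card V - 5) + 10 ≤ FF (adjN G) Finset.univ Finset.univ) :
    ∃ s : V → Bool, ∃ K : Set V, ∃ D, Strong G s K D ∧ K.Nonempty ∧ Kᶜ.ncard ≤ 4 := by
  classical
  obtain ⟨s, hs⟩ := exists_maxcut G
  obtain ⟨W, hW4, hW⟩ := exists_W G hn hm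
  obtain ⟨r, hr⟩ : ∃ r, r ∉ W := by
    by_contra! h
    have := Finset.card_le_card (fun v _ => h v : Finset.univ ⊆ W)
    rw [Finset.card_univ] at this
    omega
  let Q : Set (Set V) := {K | r ∈ K ∧ ∃ D, Strong G s K D}
  have hQ : Q.Nonempty := ⟨{r}, rfl, fun _ _ => False, by simp, by simp,
    by rintro x rfl y rfl; exact .refl⟩
  obtain ⟨K, ⟨hrK, D, hK⟩, hmax⟩ := Set.exists_max_image Q Set.ncard (Set.toFinite _) hQ
  refine ⟨s, K, D, hK, ⟨r, hrK⟩, ?_⟩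
  suffices hsub : Kᶜ ⊆ (W : Set V) by
    have := Set.ncard_le_ncard hsub (Set.toFinite _)
    rw [Set.ncard_coe_finset] at this
    omega
  intro x hx
  let R : V → V → Prop := fun u v => G.Adj u v ∧ s u ≠ s v ∧ u ∉ K ∧ v ∉ K
  have hRs : ∀ u v, Relation.ReflTransGen R u v → Relation.ReflTransGen R v u := by
    intro u v h
    induction h with
    | refl => exact .refl
    | tail _ h ih => exact .head ⟨h.1.symm, h.2.1.symm, h.2.2.2, h.2.2.1⟩ ih
  let C : Finset V := Finset.univ.filter (fun z => Relation.ReflTransGen R x z)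
  have hC : ∀ z, z ∈ C ↔ Relation.ReflTransGen R x z := by simp [C]
  have hCK : ∀ z ∈ C, z ∉ K := by
    intro z hz
    rw [hC] at hz
    induction hz with
    | refl => exact hx
    | tail _ h _ => exact h.2.2.2
  have hbi : FF (biN G s) C Cᶜ ≤ 1 := by
    unfold FF biN
    rw [← Finset.sum_product', ← Finset.card_filter]
    rw [Finset.card_le_one]
    have hw : ∀ u a, u ∈ C → a ∉ C → G.Adj u a → s u ≠ s a → a ∈ K := by
      intro u a hu ha h1 h2
      by_contra h3
      exact ha ((hC a).2 (((hC u).1 hu).tail ⟨h1, h2, hCK u hu, h3⟩))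
    rintro ⟨u, a⟩ h1 ⟨v, b⟩ h2
    simp only [Finset.mem_filter, Finset.mem_product, Finset.mem_compl] at h1 h2
    obtain ⟨⟨hu, ha⟩, ua, sua⟩ := h1
    obtain ⟨⟨hv, hb⟩, vb, svb⟩ := h2
    by_contra hne
    obtain ⟨K', D', hK', hlt⟩ := hK.ear (hw u a hu ha ua sua) (hw v b hv hb vb svb) (hCK u hu)
      (hCK v hv) ua sua vb svb (by rintro ⟨rfl, rfl⟩; exact hne rfl)
      ((hRs _ _ ((hC u).1 hu)).trans ((hC v).1 hv))
    have h1 := hmax K' ⟨hlt.1 hrK, D', hK'⟩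
    have h2 := Set.ncard_lt_ncard hlt (Set.toFinite _)
    omega
  have hcut := hs C hbi
  have hxC : x ∈ C := (hC x).2 .refl
  have hrC : r ∉ C := fun h => hCK r h hrK
  by_cases c1 : C.card ≤ 4
  · exact hW C c1 hcut hxC
  by_cases c2 : Cᶜ.card ≤ 4
  · exfalso
    apply hr
    apply hW Cᶜ c2 _ (by simpa using hrC)
    rw [compl_compl, FF_comm (adjN_comm G)]
    exact hcut
  exfalso
  have h1 := FF_adj_le G C
  have h2 := FF_adj_le G Cᶜ
  have h3 := Finset.card_compl_add_card C
  have h4 := FF_union (adjN_comm G) (disjoint_compl_right (a := C))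
  rw [Finset.union_compl] at h4
  obtain ⟨m, hm'⟩ := Nat.exists_eq_add_of_le hn
  rw [hm'] at hm h3
  have e1 : 15 + m - 4 = m + 11 := by omega
  have e2 : 15 + m - 5 = m + 10 := by omega
  rw [e1, e2] at hm
  generalize Cᶜ.card = k at *
  generalize C.card = w at *
  obtain ⟨j, rfl⟩ : ∃ j, w = j + 5 := ⟨w - 5, by omega⟩
  obtain ⟨i, rfl⟩ : ∃ i, k = i + 5 := ⟨k - 5, by omega⟩
  obtain rfl : m = i + j - 5 := by omega
  have : i + j - 5 + 5 = i + j := by omega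
  generalize i + j - 5 = m at *
  nlinarith [Nat.zero_le (i*j)]

theorem stmt16 {V : Type*} [Fintype V] (G : SimpleGraph V)
    (hn : 15 ≤ Fintype.card V) (hconn : G.Connected)
    (hm : Nat.choose (Fintype.card V - 4) 2 + 5 ≤ G.edgeSet.ncard) :
    pc G ≤ 3 := by
  classical
  have hm2 : (Fintype.card V - 4) * (Fintype.card V - 5) + 10 ≤
      FF (adjN G) Finset.univ Finset.univ := by
    rw [FF_adj_univ]
    rw [Nat.choose_two_right] at hm
    have h := Nat.even_mul_pred_self (Fintype.card V - 4)
    have h2 := Nat.two_mul_div_two_of_even h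
    have e : Fintype.card V - 4 - 1 = Fintype.card V - 5 := by omega
    rw [e] at h2 hm
    omega
  obtain ⟨s, K, D, hK, hne, h4⟩ := final_aux G hn hm2
  refine combine hK hne hconn h4 ?_
  intro h4' L hL
  by_contra! hcon
  have hKc : K.toFinset.card = Fintype.card V - 4 := by
    have := Set.ncard_add_ncard_compl K
    rw [Nat.card_eq_fintype_card] at this
    rw [← Set.ncard_eq_toFinset_card']
    omega
  have hsub : G.edgeFinset ⊆ L ∪ K.toFinset.offDiag.image (fun p => s(p.1, p.2)) := by
    intro e he
    induction e using Sym2.ind with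
    | _ u v =>
      rw [SimpleGraph.mem_edgeFinset, SimpleGraph.mem_edgeSet] at he
      by_cases hu : u ∈ K
      · by_cases hv : v ∈ K
        · apply Finset.mem_union_right
          exact Finset.mem_image.2 ⟨(u, v), by simp [hu, hv, he.ne], rfl⟩
        · apply Finset.mem_union_left
          rw [Sym2.eq_swap]
          exact hcon v hv u he.symm
      · exact Finset.mem_union_left _ (hcon u hu v he)
  have h5 := (Finset.card_le_card hsub).trans (Finset.card_union_le _ _)
  have h6 : (K.toFinset.offDiag.image (fun p => s(p.1, p.2))).card =
    K.toFinset.card.choose 2 := Sym2.card_image_offDiag _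
  rw [h6, hKc] at h5
  rw [Set.ncard_eq_toFinset_card', ← SimpleGraph.edgeFinset] at hm
  omega
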